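/- A recoverable environment is value-stable if and only if it is worst-case value-stable. -/

import Mathlib

open MeasureTheory Filter Finset Asymptotics
open scoped ENNReal Classical

noncomputable section

namespace RL

/-- A perception `x = (r, o)`: a reward `r ∈ R = {0, …, r_max}` together with an
observation `o ∈ O`. -/
abbrev Percept (O : Type) (rmax : ℕ) := Fin (rmax + 1) × O

/-- A cycle `z = (y, r, o)`: an action together with the resulting perception. -/
abbrev Cycle (Y O : Type) (rmax : ℕ) := Y × Percept O rmax

/-- A deterministic policy maps a history `z_{<k}` to the next action `y_k`. -/
abbrev Policy (Y O : Type) (rmax : ℕ) := List (Cycle Y O rmax) → Y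

/-- An infinite interaction sequence. -/
abbrev Traj (Y O : Type) (rmax : ℕ) := ℕ → Cycle Y O rmax

instance (Y O : Type) (rmax : ℕ) : MeasurableSpace (Cycle Y O rmax) := ⊤

/-- The reward of a cycle `z = (y, (r, o))`, as a real number. -/
def rew {Y O : Type} {rmax : ℕ} (z : Cycle Y O rmax) : ℝ := ((z.2.1 : ℕ) : ℝ)

/-- The cylinder set of all infinite sequences extending the finite sequence `l`. -/
def cylSet {A : Type} (l : List A) : Set (ℕ → A) := {ω | ∀ i : Fin l.length, ω i.1 = l.get i}

/-- An environment: conditional probabilities `ν(x_k | z_{<k} y_k)` of the next perception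
given the history, together with, for each (deterministic) policy `p`, the induced
probability measure on interaction sequences, which on cylinder sets is given by the
product of the conditional probabilities (actions being forced by the policy). -/
structure Environment (Y O : Type) [Fintype Y] [Fintype O] (rmax : ℕ) where
  cond : List (Cycle Y O rmax) → Y → Percept O rmax → ℝ
  cond_nonneg : ∀ h y x, 0 ≤ cond h y x
  cond_sum_one : ∀ h y, ∑ x : Percept O rmax, cond h y x = 1
  P : Policy Y O rmax → Measure (Traj Y O rmax)
  P_prob : ∀ p, IsProbabilityMeasure (P p)
  P_cyl : ∀ (p : Policy Y O rmax) (h : List (Cycle Y O rmax)) (z : Cycle Y O rmax),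
    P p (cylSet (h ++ [z]))
      = P p (cylSet h) * ENNReal.ofReal (if z.1 = p h then cond h z.1 z.2 else 0)

variable {Y O : Type} [Fintype Y] [Fintype O] {rmax : ℕ}

/-- The average reward `(1/m) r_{1..m}` of the first `m` steps of a trajectory. -/
def avg {Y O : Type} {rmax : ℕ} (ω : Traj Y O rmax) (m : ℕ) : ℝ :=
  (∑ i ∈ Finset.range m, rew (ω i)) / m

/-- `V(ν,p) = V` : the average limiting value exists a.s. and equals the constant `V`. -/
def ValueIs (ν : Environment Y O rmax) (p : Policy Y O rmax) (V : ℝ) : Prop :=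
  ν.P p {ω | Tendsto (avg ω) atTop (nhds V)} = 1

/-- `V̄(ν,p) = V` : the upper limiting average value is a.s. the constant `V`. -/
def UpperValueIs (ν : Environment Y O rmax) (p : Policy Y O rmax) (V : ℝ) : Prop :=
  ν.P p {ω | limsup (avg ω) atTop = V} = 1

/-- `V` is the optimal value `V*_ν` of `ν`: some policy `p_ν` achieves average value `V`
a.s., and every policy has upper average value `≤ V` a.s. -/
def IsOptimalValue (ν : Environment Y O rmax) (V : ℝ) : Prop :=
  ∃ p, ValueIs ν p V ∧ ∀ q : Policy Y O rmax, ν.P q {ω | limsup (avg ω) atTop ≤ V} = 1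

/-- An environment is explorable if it has an optimal value `V*_ν`. -/
def Explorable (ν : Environment Y O rmax) : Prop := ∃ V, IsOptimalValue ν V

/-- `V` is the upper optimal value `V̄*_ν` of `ν`. -/
def IsUpperOptimalValue (ν : Environment Y O rmax) (V : ℝ) : Prop :=
  ∃ p, UpperValueIs ν p V ∧ ∀ q : Policy Y O rmax, ν.P q {ω | limsup (avg ω) atTop ≤ V} = 1

/-- An environment is upper explorable if it has an upper optimal value `V̄*_ν`. -/
def UpperExplorable (ν : Environment Y O rmax) : Prop := ∃ V, IsUpperOptimalValue ν V

/-- `ν(x_{<k} | y_{<k})` : the probability of the perceptions of the history `h`,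
given its actions. -/
def histProbX (ν : Environment Y O rmax) (h : List (Cycle Y O rmax)) : ℝ :=
  ∏ i : Fin h.length, ν.cond (h.take i.1) (h.get i).1 (h.get i).2

/-- Replace the first `k-1` actions of the policy `p` by the actions `y_{<k}` of the
history `h`. -/
def replacePolicy (h : List (Cycle Y O rmax)) (p : Policy Y O rmax) : Policy Y O rmax :=
  fun l => if hl : l.length < h.length then (h.get ⟨l.length, hl⟩).1 else p l

/-- The measure induced by `(p, ν)` conditional on the history `h = z_{<k}`:
`ν`-probabilities conditional on `x_{<k}`, with the first `k-1` actions of `p`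
replaced by `y_{<k}`. -/
def condMeasure (ν : Environment Y O rmax) (p : Policy Y O rmax)
    (h : List (Cycle Y O rmax)) : Measure (Traj Y O rmax) :=
  ProbabilityTheory.cond (ν.P (replacePolicy h p)) (cylSet h)

/-- `P( · | z_{<k})` under policy `p` in environment `ν`. -/
def condProb (ν : Environment Y O rmax) (p : Policy Y O rmax)
    (h : List (Cycle Y O rmax)) (A : Set (Traj Y O rmax)) : ℝ≥0∞ :=
  condMeasure ν p h A

/-- `V(ν,p,z_{<k}) = V` : conditional on `z_{<k}`, the average limiting value is a.s. `V`. -/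
def CondValueIs (ν : Environment Y O rmax) (p : Policy Y O rmax)
    (h : List (Cycle Y O rmax)) (V : ℝ) : Prop :=
  condProb ν p h {ω | Tendsto (avg ω) atTop (nhds V)} = 1

/-- `V̄(ν,p,z_{<k}) = V` : conditional on `z_{<k}`, the upper limiting average value
is a.s. `V`. -/
def CondUpperValueIs (ν : Environment Y O rmax) (p : Policy Y O rmax)
    (h : List (Cycle Y O rmax)) (V : ℝ) : Prop :=
  condProb ν p h {ω | limsup (avg ω) atTop = V} = 1

/-- `V` is the conditional optimal value `V*_ν(z_{<k})`. -/
def IsCondOptimalValue (ν : Environment Y O rmax) (h : List (Cycle Y O rmax)) (V : ℝ) : Prop :=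
  ∃ p, CondValueIs ν p h V ∧
    ∀ q : Policy Y O rmax, condProb ν q h {ω | limsup (avg ω) atTop ≤ V} = 1

/-- `V` is the conditional upper optimal value `V̄*_ν(z_{<k})`. -/
def IsCondUpperOptimalValue (ν : Environment Y O rmax) (h : List (Cycle Y O rmax)) (V : ℝ) :
    Prop :=
  ∃ p, CondUpperValueIs ν p h V ∧
    ∀ q : Policy Y O rmax, condProb ν q h {ω | limsup (avg ω) atTop ≤ V} = 1

/-- Strongly explorable: after any history of positive probability there is a conditionally
optimal value. -/
def StronglyExplorable (ν : Environment Y O rmax) : Prop :=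
  ∀ h, 0 < histProbX ν h → ∃ V, IsCondOptimalValue ν h V

/-- Strongly upper explorable. -/
def StronglyUpperExplorable (ν : Environment Y O rmax) : Prop :=
  ∀ h, 0 < histProbX ν h → ∃ V, IsCondUpperOptimalValue ν h V

/-- The worst-case optimal value `W*_ν = inf_{z_{<k}} V*_ν(z_{<k})`. -/
def Wstar (ν : Environment Y O rmax) : ℝ :=
  sInf {V | ∃ h, 0 < histProbX ν h ∧ IsCondOptimalValue ν h V}

/-- The worst-case upper optimal value `W̄*_ν = inf_{z_{<k}} V̄*_ν(z_{<k})`. -/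
def WstarUpper (ν : Environment Y O rmax) : ℝ :=
  sInf {V | ∃ h, 0 < histProbX ν h ∧ IsCondUpperOptimalValue ν h V}

/-- Recoverable: after any history of positive probability, some policy attains the
upper optimal value `V̄*_ν` with conditional probability 1. -/
def Recoverable (ν : Environment Y O rmax) : Prop :=
  ∃ V, IsUpperOptimalValue ν V ∧
    ∀ h, 0 < histProbX ν h →
      ∃ p, condProb ν p h {ω | limsup (avg ω) atTop = V} = 1

/-- The quantitative part of value-stability, with target value `W`:
rewards `r_i ∈ [0, r_max]` with `(1/n) r_{1..n} → W`, `d(k,ε) = o(k)`,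
`Σ_n φ(n,ε) < ∞`, and from any history `z_{<k}` some policy `p` recovers:
`P( r_{k..k+n} − r^{pν}_{k..k+n} > d(k,ε) + nε | z_{<k} ) ≤ φ(n,ε)`. -/
def ValueStableCore (ν : Environment Y O rmax) (W : ℝ) (r : ℕ → ℝ)
    (d : ℕ → ℝ → ℝ) (φ : ℕ → ℝ → ℝ) : Prop :=
  (∀ i, r i ∈ Set.Icc (0 : ℝ) (rmax : ℝ)) ∧
  Tendsto (fun n => (∑ i ∈ Finset.range n, r i) / n) atTop (nhds W) ∧
  (∀ ε : ℝ, 0 < ε → (fun k : ℕ => d k ε) =o[atTop] fun k : ℕ => (k : ℝ)) ∧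
  (∀ ε : ℝ, 0 < ε → Summable fun n => φ n ε) ∧
  ∀ h : List (Cycle Y O rmax), ∃ p : Policy Y O rmax, ∀ ε : ℝ, 0 < ε → ∀ n : ℕ,
    condProb ν p h
      {ω | d h.length ε + n * ε <
        (∑ i ∈ Finset.Icc h.length (h.length + n), r i)
          - ∑ i ∈ Finset.Icc h.length (h.length + n), rew (ω i)}
      ≤ ENNReal.ofReal (φ n ε)

/-- Value-stability with explicit witnesses `V = V*_ν`, `r`, `d`, `φ`. -/
def ValueStableWith (ν : Environment Y O rmax) (V : ℝ) (r : ℕ → ℝ)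
    (d : ℕ → ℝ → ℝ) (φ : ℕ → ℝ → ℝ) : Prop :=
  IsOptimalValue ν V ∧ ValueStableCore ν V r d φ

/-- A value-stable environment. -/
def ValueStable (ν : Environment Y O rmax) : Prop :=
  ∃ V r d φ, ValueStableWith ν V r d φ

/-- A worst-case value-stable environment: strongly explorable, and the value-stability
condition holds with target `W*_ν`. -/
def WorstCaseValueStable (ν : Environment Y O rmax) : Prop :=
  StronglyExplorable ν ∧ ∃ r d φ, ValueStableCore ν (Wstar ν) r d φ

/-- A policy is self-optimizing for a class `C` if it attains the optimal value `V*_ν`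
in every `ν ∈ C`. -/
def SelfOptimizing (p : Policy Y O rmax) (C : Set (Environment Y O rmax)) : Prop :=
  ∀ ν ∈ C, ∀ V, IsOptimalValue ν V → ValueIs ν p V

/-- A policy is upper self-optimizing for a class `C` if it attains the upper optimal
value `V̄*_ν` in every `ν ∈ C`. -/
def UpperSelfOptimizing (p : Policy Y O rmax) (C : Set (Environment Y O rmax)) : Prop :=
  ∀ ν ∈ C, ∀ V, IsUpperOptimalValue ν V → UpperValueIs ν p V

/-- A deterministic environment: all conditional probabilities are `0` or `1`. -/
def Deterministic (ν : Environment Y O rmax) : Prop :=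
  ∀ h y x, ν.cond h y x = 0 ∨ ν.cond h y x = 1

/-- In a deterministic environment, the perception following history `h` and action `y`. -/
def pick [Nonempty O] (ν : Environment Y O rmax) (h : List (Cycle Y O rmax)) (y : Y) :
    Percept O rmax :=
  if hx : ∃ x, ν.cond h y x = 1 then hx.choose else Classical.arbitrary _

/-- The (deterministic) history generated by policy `p` in a deterministic environment. -/
def detHist [Nonempty O] (ν : Environment Y O rmax) (p : Policy Y O rmax) :
    ℕ → List (Cycle Y O rmax)
  | 0 => []
  | n + 1 =>
      detHist ν p n ++ [(p (detHist ν p n), pick ν (detHist ν p n) (p (detHist ν p n)))]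

/-- The cycle `z_n` generated by policy `p` in a deterministic environment. -/
def detZ [Nonempty O] (ν : Environment Y O rmax) (p : Policy Y O rmax) (n : ℕ) :
    Cycle Y O rmax :=
  (p (detHist ν p n), pick ν (detHist ν p n) (p (detHist ν p n)))

end RL

namespace RL

section Trajectories

variable {Y O : Type} {rmax : ℕ}

lemma rew_nonneg (z : Cycle Y O rmax) : 0 ≤ rew z := Nat.cast_nonneg _

lemma rew_le (z : Cycle Y O rmax) : rew z ≤ rmax :=
  Nat.cast_le.2 (Nat.lt_succ_iff.1 z.2.1.2)

lemma measurable_rew : Measurable (rew : Cycle Y O rmax → ℝ) := measurable_from_top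

lemma avg_nonneg (ω : Traj Y O rmax) (m : ℕ) : 0 ≤ avg ω m :=
  div_nonneg (Finset.sum_nonneg fun _ _ => rew_nonneg _) (Nat.cast_nonneg _)

lemma avg_le (ω : Traj Y O rmax) (m : ℕ) : avg ω m ≤ rmax := by
  refine div_le_of_le_mul₀ (Nat.cast_nonneg _) (Nat.cast_nonneg _) ?_
  calc ∑ i ∈ Finset.range m, rew (ω i) ≤ ∑ _i ∈ Finset.range m, (rmax : ℝ) :=
        Finset.sum_le_sum fun _ _ => rew_le _
    _ = rmax * m := by simp [mul_comm]

lemma isBoundedUnder_avg (ω : Traj Y O rmax) : IsBoundedUnder (· ≤ ·) atTop (avg ω) :=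
  isBoundedUnder_of ⟨rmax, avg_le ω⟩

lemma measurable_avg (m : ℕ) : Measurable fun ω : Traj Y O rmax => avg ω m :=
  (Finset.measurable_sum _ fun i _ => measurable_rew.comp (measurable_pi_apply i)).div_const _

lemma measurable_limsup_avg : Measurable fun ω : Traj Y O rmax => limsup (avg ω) atTop :=
  Measurable.limsup measurable_avg

lemma measurableSet_limsup_avg_le (V : ℝ) :
    MeasurableSet {ω : Traj Y O rmax | limsup (avg ω) atTop ≤ V} :=
  measurable_limsup_avg measurableSet_Iic

lemma measurableSet_limsup_avg_eq (V : ℝ) :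
    MeasurableSet {ω : Traj Y O rmax | limsup (avg ω) atTop = V} :=
  measurable_limsup_avg (measurableSet_singleton V)

lemma measurableSet_tendsto_avg (V : ℝ) :
    MeasurableSet {ω : Traj Y O rmax | Tendsto (avg ω) atTop (nhds V)} :=
  measurableSet_tendsto _ measurable_avg

lemma measurableSet_cylSet (h : List (Cycle Y O rmax)) : MeasurableSet (cylSet h) := by
  have : cylSet h = ⋂ i : Fin h.length, {ω : Traj Y O rmax | ω i.1 = h.get i} := by
    ext; simp [cylSet]
  rw [this]
  refine MeasurableSet.iInter fun i => ?_
  have hs : MeasurableSet {z : Cycle Y O rmax | z = h.get i} := trivial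
  exact (measurable_pi_apply (X := fun _ => Cycle Y O rmax) i.1) hs

/-- If the rewards along `ω` from time `k` on keep up with rewards averaging to `V`, up to a
constant and an arbitrarily small linear error, and the upper average of `ω` is at most `V`,
then the average reward of `ω` tends to `V`. -/
lemma tendsto_avg_of_eventually_le {ω : Traj Y O rmax} {V : ℝ} {r : ℕ → ℝ} {k : ℕ}
    (hr : Tendsto (fun n => (∑ i ∈ Finset.range n, r i) / n) atTop (nhds V))
    (hle : limsup (avg ω) atTop ≤ V)
    (hev : ∀ j : ℕ, ∃ D : ℝ, ∀ᶠ n : ℕ in atTop,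
      (∑ i ∈ Finset.Icc k (k + n), r i) - ∑ i ∈ Finset.Icc k (k + n), rew (ω i)
        ≤ D + n * (1 / ((j : ℝ) + 1))) :
    Tendsto (avg ω) atTop (nhds V) := by
  refine tendsto_order.2 ⟨fun a ha => ?_, fun a ha =>
    eventually_lt_of_limsup_lt (hle.trans_lt ha) (isBoundedUnder_avg ω)⟩
  obtain ⟨j, hj⟩ := exists_nat_one_div_lt (sub_pos.2 ha)
  obtain ⟨D, hD⟩ := hev j
  set ε : ℝ := 1 / ((j : ℝ) + 1) with hε
  have hε0 : 0 < ε := by positivity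
  set C : ℝ := (∑ i ∈ Finset.range k, r i) + D
  have hlim : Tendsto (fun m : ℕ => (∑ i ∈ Finset.range m, r i) / m - C / m - ε) atTop
      (nhds (V - 0 - ε)) :=
    (hr.sub (tendsto_const_div_atTop_nhds_zero_nat C)).sub_const ε
  have hsplit : ∀ (f : ℕ → ℝ) (n : ℕ), ∑ i ∈ Finset.Icc k (k + n), f i
      = ∑ i ∈ Finset.range (k + n + 1), f i - ∑ i ∈ Finset.range k, f i := by
    intro f n
    rw [← Finset.sum_Ico_eq_sub f (by omega)]
    rfl
  have hD' : ∀ᶠ m : ℕ in atTop,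
      (∑ i ∈ Finset.range m, r i) / m - C / m - ε ≤ avg ω m := by
    obtain ⟨N, hN⟩ := eventually_atTop.1 hD
    filter_upwards [eventually_ge_atTop (k + N + 1)] with m hm
    obtain ⟨n, rfl⟩ : ∃ n, m = k + n + 1 := ⟨m - k - 1, by omega⟩
    have h1 := hN n (by omega)
    rw [hsplit, hsplit] at h1
    have h2 : 0 ≤ ∑ i ∈ Finset.range k, rew (ω i) := Finset.sum_nonneg fun _ _ => rew_nonneg _
    have hm0 : (0 : ℝ) < (k + n + 1 : ℕ) := by positivity
    have h3 : (n : ℝ) * ε ≤ (k + n + 1 : ℕ) * ε := by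
      gcongr
      omega
    rw [avg, ← sub_div, sub_le_iff_le_add, div_le_iff₀ hm0, add_mul, div_mul_cancel₀ _ hm0.ne']
    simp only [C]
    linarith
  filter_upwards [hlim.eventually_const_lt (show a < V - 0 - ε by linarith), hD'] with m h1 h2
  exact h1.trans_le h2

end Trajectories

variable {Y O : Type} [Fintype Y] [Fintype O] {rmax : ℕ}

lemma cond_pos_of_histProbX_pos {ν : Environment Y O rmax} {h : List (Cycle Y O rmax)}
    (hh : 0 < histProbX ν h) (i : ℕ) (hi : i < h.length) :
    0 < ν.cond (h.take i) h[i].1 h[i].2 := by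
  refine (ν.cond_nonneg _ _ _).lt_of_ne' fun h0 => hh.ne' ?_
  exact Finset.prod_eq_zero (Finset.mem_univ (⟨i, hi⟩ : Fin h.length)) h0

/-- A history consistent with the policy `π`, all of whose perceptions have positive
conditional probability, has positive probability under `π`. -/
lemma measure_cylSet_ne_zero (ν : Environment Y O rmax) (π : Policy Y O rmax)
    (l : List (Cycle Y O rmax))
    (hπ : ∀ (i : ℕ) (hi : i < l.length), l[i].1 = π (l.take i))
    (hpos : ∀ (i : ℕ) (hi : i < l.length), 0 < ν.cond (l.take i) l[i].1 l[i].2) :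
    ν.P π (cylSet l) ≠ 0 := by
  induction l using List.reverseRecOn with
  | nil =>
    have := ν.P_prob π
    have : cylSet ([] : List (Cycle Y O rmax)) = Set.univ := by
      ext; simp [cylSet]
    simp [this]
  | append_singleton l z ih =>
    have hz := hπ l.length (by simp)
    have hzpos := hpos l.length (by simp)
    simp only [List.getElem_concat_length, List.take_left] at hz hzpos
    rw [ν.P_cyl, if_pos hz]
    refine mul_ne_zero (ih (fun i hi => ?_) fun i hi => ?_) (by simpa using hzpos)
    · have := hπ i (by simp; omega)
      rwa [List.getElem_append_left hi, List.take_append_of_le_length hi.le] at this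
    · have := hpos i (by simp; omega)
      rwa [List.getElem_append_left hi, List.take_append_of_le_length hi.le] at this

lemma measure_replacePolicy_cylSet_ne_zero {ν : Environment Y O rmax}
    {h : List (Cycle Y O rmax)} (hh : 0 < histProbX ν h) (p : Policy Y O rmax) :
    ν.P (replacePolicy h p) (cylSet h) ≠ 0 := by
  refine measure_cylSet_ne_zero ν _ h (fun i hi => ?_) (cond_pos_of_histProbX_pos hh)
  simp [replacePolicy, hi, hi.le]

lemma isProbabilityMeasure_condMeasure {ν : Environment Y O rmax}
    {h : List (Cycle Y O rmax)} (hh : 0 < histProbX ν h) (p : Policy Y O rmax) :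
    IsProbabilityMeasure (condMeasure ν p h) :=
  have := ν.P_prob (replacePolicy h p)
  ProbabilityTheory.cond_isProbabilityMeasure (measure_replacePolicy_cylSet_ne_zero hh p)

lemma condProb_eq_one_iff {ν : Environment Y O rmax} {h : List (Cycle Y O rmax)}
    (hh : 0 < histProbX ν h) (p : Policy Y O rmax) {A : Set (Traj Y O rmax)}
    (hA : MeasurableSet A) : condProb ν p h A = 1 ↔ ∀ᵐ ω ∂condMeasure ν p h, ω ∈ A := by
  have := isProbabilityMeasure_condMeasure hh p
  exact (mem_ae_iff_prob_eq_one hA).symm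

lemma condProb_eq_one_of_forall {ν : Environment Y O rmax} {A : Set (Traj Y O rmax)}
    (hA : MeasurableSet A) (hν : ∀ q, ν.P q A = 1) {h : List (Cycle Y O rmax)}
    (hh : 0 < histProbX ν h) (p : Policy Y O rmax) : condProb ν p h A = 1 := by
  have := ν.P_prob (replacePolicy h p)
  rw [condProb_eq_one_iff hh p hA]
  exact ProbabilityTheory.cond_absolutelyContinuous.ae_le
    ((mem_ae_iff_prob_eq_one hA).2 (hν _))

lemma histProbX_nil (ν : Environment Y O rmax) : histProbX ν [] = 1 := by
  simp [histProbX]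

lemma condProb_nil (ν : Environment Y O rmax) (p : Policy Y O rmax) (A : Set (Traj Y O rmax)) :
    condProb ν p [] A = ν.P p A := by
  have := ν.P_prob p
  have h1 : replacePolicy [] p = p := by
    funext l; simp [replacePolicy]
  have h2 : cylSet ([] : List (Cycle Y O rmax)) = Set.univ := by
    ext; simp [cylSet]
  simp [condProb, condMeasure, h1, h2]

/-- If some policy attains upper value at least `V` given `h`, then any conditional optimal value
given `h` is at least `V`. -/
lemma IsCondOptimalValue.le_of_condUpperValueIs {ν : Environment Y O rmax}
    {h : List (Cycle Y O rmax)} (hh : 0 < histProbX ν h) {V V' : ℝ} {p : Policy Y O rmax}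
    (hV' : IsCondOptimalValue ν h V') (hp : CondUpperValueIs ν p h V) : V ≤ V' := by
  obtain ⟨_, _, hle⟩ := hV'
  have := isProbabilityMeasure_condMeasure hh p
  obtain ⟨ω, h1, h2⟩ := (((condProb_eq_one_iff hh p (measurableSet_limsup_avg_eq V)).1 hp).and
    ((condProb_eq_one_iff hh p (measurableSet_limsup_avg_le V')).1 (hle p))).exists
  exact h1.symm.le.trans h2

lemma CondValueIs.condUpperValueIs {ν : Environment Y O rmax} {h : List (Cycle Y O rmax)}
    (hh : 0 < histProbX ν h) {V : ℝ} {p : Policy Y O rmax} (hp : CondValueIs ν p h V) :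
    CondUpperValueIs ν p h V := by
  rw [CondValueIs, condProb_eq_one_iff hh p (measurableSet_tendsto_avg V)] at hp
  rw [CondUpperValueIs, condProb_eq_one_iff hh p (measurableSet_limsup_avg_eq V)]
  filter_upwards [hp] with ω hω using Tendsto.limsup_eq hω

lemma IsCondOptimalValue.unique {ν : Environment Y O rmax} {h : List (Cycle Y O rmax)}
    (hh : 0 < histProbX ν h) {V V' : ℝ} (hV : IsCondOptimalValue ν h V)
    (hV' : IsCondOptimalValue ν h V') : V = V' := by
  obtain ⟨p, hp, -⟩ := id hV
  obtain ⟨p', hp', -⟩ := id hV'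
  exact le_antisymm (hV'.le_of_condUpperValueIs hh (hp.condUpperValueIs hh))
    (hV.le_of_condUpperValueIs hh (hp'.condUpperValueIs hh))

lemma Wstar_eq_of_forall {ν : Environment Y O rmax} {V : ℝ}
    (hV : ∀ h, 0 < histProbX ν h → IsCondOptimalValue ν h V) : Wstar ν = V := by
  have : {U | ∃ h, 0 < histProbX ν h ∧ IsCondOptimalValue ν h U} = {V} := by
    ext U
    constructor
    · rintro ⟨h, hh, hU⟩
      exact hU.unique hh (hV h hh)
    · rintro rfl
      have h0 : 0 < histProbX ν [] := by simp [histProbX_nil]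
      exact ⟨[], h0, hV [] h0⟩
  rw [Wstar, this, csInf_singleton]

/-- In a value-stable environment the optimal value can be attained after every history of
positive probability. -/
lemma ValueStableWith.isCondOptimalValue {ν : Environment Y O rmax} {V : ℝ} {r : ℕ → ℝ}
    {d φ : ℕ → ℝ → ℝ} (hvs : ValueStableWith ν V r d φ) {h : List (Cycle Y O rmax)}
    (hh : 0 < histProbX ν h) : IsCondOptimalValue ν h V := by
  obtain ⟨⟨_, _, hle⟩, _, hr, _, hφ, hcore⟩ := hvs
  have hle' := fun q => condProb_eq_one_of_forall (measurableSet_limsup_avg_le V) hle hh q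
  obtain ⟨p, hp⟩ := hcore h
  refine ⟨p, ?_, hle'⟩
  rw [CondValueIs, condProb_eq_one_iff hh p (measurableSet_tendsto_avg V)]
  have hbc : ∀ j : ℕ, ∀ᵐ ω ∂condMeasure ν p h, ∀ᶠ n : ℕ in atTop,
      ω ∉ {ω : Traj Y O rmax | d h.length (1 / ((j : ℝ) + 1)) + n * (1 / ((j : ℝ) + 1)) <
        (∑ i ∈ Finset.Icc h.length (h.length + n), r i)
          - ∑ i ∈ Finset.Icc h.length (h.length + n), rew (ω i)} := fun j => by
    have hε : 0 < 1 / ((j : ℝ) + 1) := by positivity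
    exact ae_eventually_notMem
      (ne_top_of_le_ne_top (hφ _ hε).tsum_ofReal_ne_top (ENNReal.tsum_le_tsum (hp _ hε)))
  filter_upwards [ae_all_iff.2 hbc,
    (condProb_eq_one_iff hh p (measurableSet_limsup_avg_le V)).1 (hle' p)] with ω h1 h2
  exact tendsto_avg_of_eventually_le hr h2 fun j =>
    ⟨_, (h1 j).mono fun n hn => not_lt.1 hn⟩

/-- In a recoverable environment every conditional optimal value equals the upper optimal
value. -/
lemma IsCondOptimalValue.eq_of_recovers {ν : Environment Y O rmax} {V V' : ℝ}
    (hV : IsUpperOptimalValue ν V) {h : List (Cycle Y O rmax)} (hh : 0 < histProbX ν h)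
    {p : Policy Y O rmax} (hp : CondUpperValueIs ν p h V) (hV' : IsCondOptimalValue ν h V') :
    V' = V := by
  refine le_antisymm ?_ (hV'.le_of_condUpperValueIs hh hp)
  obtain ⟨_, _, hle⟩ := hV
  obtain ⟨q, hq, -⟩ := hV'
  have hle' := condProb_eq_one_of_forall (measurableSet_limsup_avg_le V) hle hh q
  have := isProbabilityMeasure_condMeasure hh q
  obtain ⟨ω, h1, h2⟩ := (((condProb_eq_one_iff hh q (measurableSet_limsup_avg_eq V')).1
    (hq.condUpperValueIs hh)).and
    ((condProb_eq_one_iff hh q (measurableSet_limsup_avg_le V)).1 hle')).exists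
  exact h1.symm.le.trans h2

/-- **A recoverable environment is value-stable if and only if it is worst-case
value-stable.** -/
theorem recoverable_valueStable_iff_worstCase {Y O : Type} [Fintype Y] [Fintype O]
    [Nonempty Y] [Nonempty O] {rmax : ℕ}
    (ν : Environment Y O rmax) (hrec : Recoverable ν) :
    ValueStable ν ↔ WorstCaseValueStable ν := by
  constructor
  · rintro ⟨V, r, d, φ, hvs⟩
    have hV := fun h (hh : 0 < histProbX ν h) => hvs.isCondOptimalValue hh
    refine ⟨fun h hh => ⟨V, hV h hh⟩, r, d, φ, ?_⟩
    rw [Wstar_eq_of_forall hV]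
    exact hvs.2
  · rintro ⟨hse, r, d, φ, hcore⟩
    obtain ⟨V, hV, hrecV⟩ := hrec
    have hVc : ∀ h, 0 < histProbX ν h → IsCondOptimalValue ν h V := fun h hh => by
      obtain ⟨V', hV'⟩ := hse h hh
      obtain ⟨p, hp⟩ := hrecV h hh
      exact hV'.eq_of_recovers hV hh hp ▸ hV'
    rw [Wstar_eq_of_forall hVc] at hcore
    refine ⟨V, r, d, φ, ?_, hcore⟩
    simpa only [IsOptimalValue, ValueIs, IsCondOptimalValue, CondValueIs, condProb_nil] using
      hVc [] (by simp [histProbX_nil])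

end RL
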